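/- Let X be a real locally convex Hausdorff topological vector space and f₁, f₂: X → ℝ∪{+∞} proper convex functions. Suppose one of the following holds: (a) X = ℝⁿ and ri(dom f₁) ∩ ri(dom f₂) ≠ ∅; (b) X = ℝⁿ, f₂ is polyhedral convex, and ri(dom f₁) ∩ dom f₂ ≠ ∅; (c) f₁ is continuous at some point ū ∈ dom f₁ ∩ dom f₂; (d) X = ℝⁿ, f₁ and f₂ are polyhedral convex, and dom f₁ ∩ dom f₂ ≠ ∅; (e) X is a Banach space, f₁ and f₂ are lower semicontinuous, and 0 ∈ sqri(dom f₁ − dom f₂). Then for every x* ∈ X*, (f₁+f₂)*(x*) = (f₁* □ f₂*)(x*), the infimum in (f₁* □ f₂*)(x*) = inf{f₁*(x₁*) + f₂*(x₂*) | x₁* + x₂* = x*} is attained whenever (f₁+f₂)*(x*) ∈ ℝ, and ∂(f₁+f₂)(x̄) = ∂f₁(x̄) + ∂f₂(x̄) for every x̄ ∈ dom f₁ ∩ dom f₂. -/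

import Mathlib

open Pointwise

noncomputable section

variable {X : Type*} [NormedAddCommGroup X] [NormedSpace ℝ X]

/-- Fenchel conjugate of an extended-real-valued function:
`f*(x*) = sup {⟨x*, x⟩ - f x | x ∈ X}`. -/
def fConj (f : X → EReal) (xs : X →L[ℝ] ℝ) : EReal :=
  ⨆ x : X, (((xs x : ℝ) : EReal) - f x)

/-- Epigraph of an extended-real-valued function. -/
def epi (f : X → EReal) : Set (X × ℝ) := {p : X × ℝ | f p.1 ≤ (p.2 : EReal)}

/-- Subdifferential of `f` at `xb`:
`∂f(xb) = {x* | ⟨x*, x - xb⟩ ≤ f x - f xb for all x}`. -/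
def subdiff (f : X → EReal) (xb : X) : Set (X →L[ℝ] ℝ) :=
  {xs | ∀ x : X, ((xs x - xs xb : ℝ) : EReal) ≤ f x - f xb}

/-- A polyhedral convex function: the epigraph is a finite intersection of half-spaces
determined by continuous linear functionals. -/
def IsPolyFun (f : X → EReal) : Prop :=
  ∃ (m : ℕ) (a : Fin m → (X →L[ℝ] ℝ)) (c : Fin m → ℝ) (b : Fin m → ℝ),
    epi f = {p : X × ℝ | ∀ i, a i p.1 + c i * p.2 ≤ b i}

/-- The cone generated by a set: `cone A = {t • a | t ≥ 0, a ∈ A}`. -/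
def coneGen {W : Type*} [AddCommGroup W] [Module ℝ W] (A : Set W) : Set W :=
  {x | ∃ t : ℝ, 0 ≤ t ∧ ∃ a ∈ A, x = t • a}

/-- `0 ∈ sqri A`: `0 ∈ A` and the cone generated by `A` is a closed linear subspace. -/
def ZeroSqri {W : Type*} [NormedAddCommGroup W] [NormedSpace ℝ W] (A : Set W) : Prop :=
  (0 : W) ∈ A ∧ ∃ S : Submodule ℝ W, (S : Set W) = coneGen A ∧ IsClosed (S : Set W)

section Multipliers

variable {E : Type*} [AddCommGroup E] [Module ℝ E]

/-- `u` is an algebraic relative interior point of `C`: every segment of `C` ending at `u` can be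
prolonged beyond `u` inside `C`. -/
def IsAlgRelInterior (C : Set E) (u : E) : Prop :=
  u ∈ C ∧ ∀ z ∈ C, ∃ ε : ℝ, 0 < ε ∧ u + ε • (u - z) ∈ C

theorem isAlgRelInterior_univ (u : E) : IsAlgRelInterior Set.univ u :=
  ⟨trivial, fun _ _ => ⟨1, one_pos, trivial⟩⟩

theorem add_smul_sub_mem_of_le {C : Set E} (hC : Convex ℝ C) {u z : E} (hu : u ∈ C) {ε t : ℝ}
    (h : u + ε • (u - z) ∈ C) (ht : 0 ≤ t) (hε : 0 < ε) (hte : t ≤ ε) :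
    u + t • (u - z) ∈ C := by
  have := hC.add_smul_sub_mem hu h (t := t / ε) ⟨by positivity, (div_le_one hε).2 hte⟩
  rwa [add_sub_cancel_left, smul_smul, div_mul_cancel₀ _ hε.ne'] at this

theorem IsAlgRelInterior.prod {F : Type*} [AddCommGroup F] [Module ℝ F] {C : Set E} {D : Set F}
    {u : E} {v : F} (hC : Convex ℝ C) (hD : Convex ℝ D) (hu : IsAlgRelInterior C u)
    (hv : IsAlgRelInterior D v) : IsAlgRelInterior (C ×ˢ D) (u, v) := by
  refine ⟨⟨hu.1, hv.1⟩, fun z hz => ?_⟩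
  obtain ⟨ε, hε, h⟩ := hu.2 z.1 hz.1
  obtain ⟨δ, hδ, h'⟩ := hv.2 z.2 hz.2
  have hm : 0 < min ε δ := lt_min hε hδ
  exact ⟨min ε δ, hm,
    add_smul_sub_mem_of_le hC hu.1 h hm.le hε (min_le_left _ _),
    add_smul_sub_mem_of_le hD hv.1 h' hm.le hδ (min_le_right _ _)⟩

theorem AffineMap.apply_add_smul_sub (L : E →ᵃ[ℝ] ℝ) (u z : E) (t : ℝ) :
    L (u + t • (u - z)) = L u + t * (L u - L z) := by
  have h : u + t • (u - z) = AffineMap.lineMap u z (-t) := by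
    rw [AffineMap.lineMap_apply_module']
    module
  rw [h, AffineMap.apply_lineMap, AffineMap.lineMap_apply_module']
  simp only [smul_eq_mul]
  ring

theorem AffineMap.apply_combo (L : E →ᵃ[ℝ] ℝ) (u z : E) {s t : ℝ} (h : s + t = 1) :
    L (s • u + t • z) = s * L u + t * L z := by
  obtain rfl : s = 1 - t := by linarith
  have h : (1 - t) • u + t • z = u + (-t) • (u - z) := by module
  rw [h, L.apply_add_smul_sub]
  ring

theorem AffineMap.add_sum_smul_apply {ι : Type*} (L : E →ᵃ[ℝ] ℝ) (l : ι → E →ᵃ[ℝ] ℝ)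
    (c : ι → ℝ) (s : Finset ι) (z : E) :
    (L + ∑ i ∈ s, c i • l i) z = L z + ∑ i ∈ s, c i * l i z := by
  classical
  induction s using Finset.induction_on with
  | empty => simp
  | insert a t ha ih =>
    rw [Finset.sum_insert ha, Finset.sum_insert ha, add_left_comm, AffineMap.coe_add,
      Pi.add_apply, ih, AffineMap.coe_smul, Pi.smul_apply, smul_eq_mul]
    ring

/-- An affine function vanishing at a relative interior point and nonnegative on the set vanishes
on the set. -/
theorem IsAlgRelInterior.eq_zero_of_nonneg {C : Set E} {u : E} (hu : IsAlgRelInterior C u)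
    {L : E →ᵃ[ℝ] ℝ} (hL : ∀ z ∈ C, 0 ≤ L z) (h0 : L u = 0) {z : E} (hz : z ∈ C) : L z = 0 := by
  obtain ⟨ε, hε, h⟩ := hu.2 z hz
  have h1 := hL _ h
  rw [L.apply_add_smul_sub, h0] at h1
  have h2 := hL z hz
  nlinarith

theorem IsAlgRelInterior.inter_zero {C : Set E} {u : E} (hu : IsAlgRelInterior C u)
    {l : E →ᵃ[ℝ] ℝ} (h0 : l u = 0) : IsAlgRelInterior (C ∩ {z | l z = 0}) u := by
  refine ⟨⟨hu.1, h0⟩, fun z hz => ?_⟩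
  obtain ⟨ε, hε, h⟩ := hu.2 z hz.1
  refine ⟨ε, hε, h, ?_⟩
  have : l z = 0 := hz.2
  simp [l.apply_add_smul_sub, h0, this]

theorem convex_inter_zero {C : Set E} (hC : Convex ℝ C) (l : E →ᵃ[ℝ] ℝ) :
    Convex ℝ (C ∩ {z | l z = 0}) :=
  hC.inter ((convex_singleton (0 : ℝ)).affine_preimage l)

theorem neg_div_le_div_neg {C : Set E} (hC : Convex ℝ C) {G l : E →ᵃ[ℝ] ℝ}
    (hG : ∀ z ∈ C, l z = 0 → 0 ≤ G z) {z w : E} (hz : z ∈ C) (hlz : 0 < l z) (hw : w ∈ C)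
    (hlw : l w < 0) : -G z / l z ≤ G w / (-l w) := by
  have hd : 0 < l z - l w := by linarith
  have hst : (-l w) / (l z - l w) + l z / (l z - l w) = 1 := by
    rw [← add_div, div_eq_one_iff_eq hd.ne']
    ring
  have hmem := hC hz hw (div_nonneg (by linarith) hd.le) (div_nonneg hlz.le hd.le) hst
  have hp := hG _ hmem (by rw [l.apply_combo _ _ hst]; field_simp; ring)
  rw [G.apply_combo _ _ hst, div_mul_eq_mul_div, div_mul_eq_mul_div, ← add_div,
    le_div_iff₀ hd] at hp
  rw [div_le_div_iff₀ hlz (by linarith)]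
  linarith

/-- If `G` is nonnegative on the slice `l = 0` of a convex set, then `G + α l` is nonnegative on
the whole set, where `α` is the infimum of the slopes on the side `l < 0`. -/
theorem exists_multiplier_aux {C : Set E} (hC : Convex ℝ C) {G l : E →ᵃ[ℝ] ℝ}
    (hG : ∀ z ∈ C, l z = 0 → 0 ≤ G z) (hw : ∃ w ∈ C, l w < 0) {β : ℝ}
    (hβ : ∀ w ∈ C, l w < 0 → β ≤ G w / (-l w)) :
    ∃ α : ℝ, β ≤ α ∧ ∀ z ∈ C, 0 ≤ G z + α * l z := by
  set U : Set ℝ := {q | ∃ w ∈ C, l w < 0 ∧ q = G w / (-l w)} with hU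
  have hne : U.Nonempty := by
    obtain ⟨w, hw, hl⟩ := hw
    exact ⟨_, w, hw, hl, rfl⟩
  have hbd : β ∈ lowerBounds U := by
    rintro _ ⟨w, hw, hl, rfl⟩
    exact hβ w hw hl
  refine ⟨sInf U, le_csInf hne hbd, fun z hz => ?_⟩
  rcases lt_trichotomy (l z) 0 with h | h | h
  · have h1 : sInf U ≤ G z / (-l z) := csInf_le ⟨β, hbd⟩ ⟨z, hz, h, rfl⟩
    rw [le_div_iff₀ (by linarith)] at h1
    linarith
  · rw [h, mul_zero, add_zero]
    exact hG z hz h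
  · have h1 : -G z / l z ≤ sInf U := by
      refine le_csInf hne ?_
      rintro _ ⟨w, hw, hl, rfl⟩
      exact neg_div_le_div_neg hC hG hz h hw hl
    rw [div_le_iff₀ h] at h1
    linarith

theorem exists_multiplier_of_le {C : Set E} (hC : Convex ℝ C) {G l : E →ᵃ[ℝ] ℝ}
    (hG : ∀ z ∈ C, l z ≤ 0 → 0 ≤ G z) (hw : ∃ w ∈ C, l w < 0) :
    ∃ α : ℝ, 0 ≤ α ∧ ∀ z ∈ C, 0 ≤ G z + α * l z :=
  exists_multiplier_aux hC (fun z hz h => hG z hz h.le) hw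
    fun w hw h => div_nonneg (hG w hw h.le) (by linarith)

theorem exists_multiplier_of_eq {C : Set E} (hC : Convex ℝ C) {u : E}
    (hu : IsAlgRelInterior C u) {G l : E →ᵃ[ℝ] ℝ} (h0 : l u = 0)
    (hG : ∀ z ∈ C, l z = 0 → 0 ≤ G z) :
    ∃ α : ℝ, ∀ z ∈ C, 0 ≤ G z + α * l z := by
  by_cases hw : ∃ w ∈ C, l w < 0
  · obtain ⟨w, hwC, hlw⟩ := id hw
    obtain ⟨ε, hε, hz⟩ := hu.2 w hwC
    set z := u + ε • (u - w) with hzdef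
    have hlz : 0 < l z := by
      rw [hzdef, l.apply_add_smul_sub, h0]
      nlinarith
    obtain ⟨α, -, h⟩ := exists_multiplier_aux hC hG hw (β := -G z / l z) fun w hw hl =>
      neg_div_le_div_neg hC hG hz hlz hw hl
    exact ⟨α, h⟩
  · push Not at hw
    refine ⟨0, fun z hz => ?_⟩
    rw [zero_mul, add_zero]
    exact hG z hz (hu.eq_zero_of_nonneg hw h0 hz)

/-- Lagrange multipliers for affine inequality constraints on a convex set: no strict feasibility
is needed, only feasibility of a relative interior point. -/
theorem exists_multipliers {ι : Type*} (l : ι → E →ᵃ[ℝ] ℝ) (s : Finset ι) {u : E}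
    {C : Set E} (hC : Convex ℝ C) (hu : IsAlgRelInterior C u) (hl : ∀ i ∈ s, l i u ≤ 0)
    {L : E →ᵃ[ℝ] ℝ} (hL : ∀ z ∈ C, (∀ i ∈ s, l i z ≤ 0) → 0 ≤ L z) :
    ∃ c : ι → ℝ, (∀ i, 0 ≤ c i) ∧ ∀ z ∈ C, 0 ≤ L z + ∑ i ∈ s, c i * l i z := by
  classical
  induction s using Finset.induction_on generalizing C L with
  | empty => exact ⟨0, fun _ => le_rfl, fun z hz => by simpa using hL z hz (by simp)⟩
  | insert j s hj ih =>
    have hls : ∀ i ∈ s, l i u ≤ 0 := fun i hi => hl i (Finset.mem_insert_of_mem hi)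
    have hsum : ∀ (c : ι → ℝ) (α : ℝ) (z : E),
        ∑ i ∈ insert j s, Function.update c j α i * l i z = α * l j z + ∑ i ∈ s, c i * l i z := by
      intro c α z
      rw [Finset.sum_insert hj, Function.update_self]
      congr 1
      refine Finset.sum_congr rfl fun i hi => ?_
      rw [Function.update_of_ne (fun h : i = j => hj (h ▸ hi))]
    have hupd : ∀ (c : ι → ℝ) (α : ℝ), (∀ i, 0 ≤ c i) → 0 ≤ α →
        ∀ i, 0 ≤ Function.update c j α i := by
      intro c α hc hα i
      rcases eq_or_ne i j with rfl | h
      · simpa using hα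
      · simpa [Function.update_of_ne h] using hc i
    by_cases hw : ∃ w ∈ C ∩ ⋂ i ∈ s, {z | l i z ≤ 0}, l j w < 0
    · have hC' : Convex ℝ (C ∩ ⋂ i ∈ s, {z | l i z ≤ 0}) :=
        hC.inter (convex_iInter₂ fun i _ => (convex_Iic (0 : ℝ)).affine_preimage (l i))
      obtain ⟨α, hα, h⟩ := exists_multiplier_of_le hC' (G := L) (l := l j) (by
        rintro z ⟨hz, hzs⟩ hzj
        refine hL z hz fun i hi => ?_
        rcases Finset.mem_insert.1 hi with rfl | hi
        · exact hzj
        · exact Set.mem_iInter₂.1 hzs i hi) hw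
      obtain ⟨c, hc, hcz⟩ := ih hC hu hls (L := L + α • l j) (by
        intro z hz hzs
        exact h z ⟨hz, Set.mem_iInter₂.2 hzs⟩)
      refine ⟨Function.update c j α, hupd c α hc hα, fun z hz => ?_⟩
      rw [hsum, ← add_assoc]
      exact hcz z hz
    · push Not at hw
      obtain ⟨μ, hμ, hμz⟩ := ih hC hu hls (L := l j)
        fun z hz hzs => hw z ⟨hz, Set.mem_iInter₂.2 hzs⟩
      have hju : l j u ≤ 0 := hl j (Finset.mem_insert_self _ _)
      have hsu : ∑ i ∈ s, μ i * l i u ≤ 0 :=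
        Finset.sum_nonpos fun i hi => mul_nonpos_of_nonneg_of_nonpos (hμ i) (hls i hi)
      have hju0 : l j u = 0 := by linarith [hμz u hu.1]
      have hzero : ∀ z ∈ C, l j z + ∑ i ∈ s, μ i * l i z = 0 := by
        intro z hz
        rw [← AffineMap.add_sum_smul_apply]
        refine hu.eq_zero_of_nonneg (fun z hz => ?_) ?_ hz
        · rw [AffineMap.add_sum_smul_apply]
          exact hμz z hz
        · rw [AffineMap.add_sum_smul_apply]
          linarith [hμz u hu.1]
      obtain ⟨c, hc, hcz⟩ := ih (convex_inter_zero hC (l j)) (hu.inter_zero hju0) hls (L := L) (by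
        rintro z ⟨hz, hz0 : l j z = 0⟩ hzs
        refine hL z hz fun i hi => ?_
        rcases Finset.mem_insert.1 hi with rfl | hi
        · exact hz0.le
        · exact hzs i hi)
      obtain ⟨α, hα⟩ := exists_multiplier_of_eq hC hu hju0
        (G := L + ∑ i ∈ s, c i • l i) (fun z hz hz0 => by
          rw [AffineMap.add_sum_smul_apply]
          exact hcz z ⟨hz, hz0⟩)
      refine ⟨Function.update (fun i => c i + max (-α) 0 * μ i) j (α + max (-α) 0),
        hupd _ _ (fun i => ?_) (by linarith [le_max_left (-α) 0]), fun z hz => ?_⟩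
      · have := hμ i
        have := hc i
        have := le_max_right (-α) 0
        positivity
      · have h1 := hα z hz
        have h2 := hzero z hz
        rw [AffineMap.add_sum_smul_apply] at h1
        rw [hsum]
        simp only [add_mul, Finset.sum_add_distrib, mul_assoc, ← Finset.mul_sum]
        have h3 : max (-α) 0 * (l j z + ∑ i ∈ s, μ i * l i z) = 0 := by rw [h2, mul_zero]
        linarith

end Multipliers

theorem Convex.sum_half_pow_mem {A : Set X} (hA : Convex ℝ A) {c : X} (hc : c ∈ A) (n : ℕ)
    {a : ℕ → X} (ha : ∀ i, a i ∈ A) :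
    ∑ i ∈ Finset.range n, (1 / 2 : ℝ) ^ (i + 1) • a i + (1 / 2 : ℝ) ^ n • c ∈ A := by
  induction n generalizing a with
  | zero => simpa using hc
  | succ n ih =>
    have h := hA (ha 0) (ih fun i => ha (i + 1)) (a := 1 / 2) (b := 1 / 2) (by norm_num)
      (by norm_num) (by norm_num)
    convert h using 1
    rw [Finset.sum_range_succ', smul_add, Finset.smul_sum, smul_smul]
    simp only [smul_smul, ← pow_succ']
    simp only [zero_add, pow_one]
    abel

theorem Convex.hasSum_half_pow_mem {A : Set X} (hA : Convex ℝ A) (hcl : IsClosed A)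
    {a : ℕ → X} (ha : ∀ i, a i ∈ A) {s : X} (hs : HasSum (fun i => (1 / 2 : ℝ) ^ (i + 1) • a i) s) :
    s ∈ A := by
  have h1 : Filter.Tendsto (fun n : ℕ => (1 / 2 : ℝ) ^ n • a 0) Filter.atTop (nhds 0) := by
    simpa using (tendsto_pow_atTop_nhds_zero_of_lt_one (by norm_num : (0 : ℝ) ≤ 1 / 2)
      (by norm_num)).smul_const (a 0)
  have h2 := hs.tendsto_sum_nat.add h1
  rw [add_zero] at h2
  exact hcl.mem_of_tendsto h2
    (Filter.Eventually.of_forall fun n => hA.sum_half_pow_mem (ha 0) n ha)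

theorem summable_half_pow_smul [CompleteSpace X] {a : ℕ → X} {R : ℝ} (ha : ∀ i, ‖a i‖ ≤ R) :
    Summable fun i => (1 / 2 : ℝ) ^ (i + 1) • a i := by
  have hg : Summable fun i : ℕ => (1 / 2 : ℝ) ^ i * R :=
    (summable_geometric_of_lt_one (by norm_num) (by norm_num)).mul_right R
  refine Summable.of_norm_bounded hg fun i => ?_
  have h0 : 0 ≤ R := (norm_nonneg _).trans (ha 0)
  rw [norm_smul, norm_pow, Real.norm_of_nonneg (by norm_num : (0 : ℝ) ≤ 1 / 2), pow_succ]
  have hp : (0 : ℝ) ≤ (1 / 2) ^ i := by positivity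
  have := mul_le_mul_of_nonneg_left (ha i) hp
  have := norm_nonneg (a i)
  nlinarith [mul_nonneg hp this]

/-- If the difference of two bounded closed convex sets is dense in a ball of a subspace
containing it, then it contains the ball of half the radius. -/
theorem mem_sub_of_ball_subset_closure [CompleteSpace X] {A B : Set X} (hA : Convex ℝ A)
    (hB : Convex ℝ B) (hAc : IsClosed A) (hBc : IsClosed B) {R : ℝ} (hAR : ∀ x ∈ A, ‖x‖ ≤ R)
    (hBR : ∀ x ∈ B, ‖x‖ ≤ R) {S : Submodule ℝ X} (hS : A - B ⊆ S) {δ : ℝ} (hδ : 0 < δ)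
    (h : ∀ y ∈ S, ‖y‖ < δ → y ∈ closure (A - B)) {y : X} (hy : y ∈ S) (hyδ : ‖y‖ < δ / 2) :
    y ∈ A - B := by
  have key : ∀ y : {y : X // y ∈ S ∧ ‖y‖ < δ}, ∃ p : X × X, p.1 ∈ A ∧ p.2 ∈ B ∧
      ‖(y : X) - (p.1 - p.2)‖ < δ / 2 := by
    rintro ⟨y, hy, hyδ⟩
    obtain ⟨_, ⟨a, ha, b, hb, rfl⟩, hd⟩ :=
      Metric.mem_closure_iff.1 (h y hy hyδ) (δ / 2) (by linarith)
    exact ⟨(a, b), ha, hb, by rwa [← dist_eq_norm]⟩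
  choose p hpA hpB hp using key
  let next : {y : X // y ∈ S ∧ ‖y‖ < δ} → {y : X // y ∈ S ∧ ‖y‖ < δ} := fun y =>
    ⟨(2 : ℝ) • ((y : X) - ((p y).1 - (p y).2)),
      S.smul_mem _ (S.sub_mem y.2.1 (hS (Set.sub_mem_sub (hpA y) (hpB y)))), by
        rw [norm_smul, Real.norm_of_nonneg zero_le_two]
        linarith [hp y]⟩
  have hy2 : (2 : ℝ) • y ∈ S ∧ ‖(2 : ℝ) • y‖ < δ := by
    refine ⟨S.smul_mem _ hy, ?_⟩
    rw [norm_smul, Real.norm_of_nonneg zero_le_two]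
    linarith
  let u : ℕ → {y : X // y ∈ S ∧ ‖y‖ < δ} := fun n => next^[n] ⟨(2 : ℝ) • y, hy2⟩
  have hu : ∀ n, ((u (n + 1) : X)) = (2 : ℝ) • ((u n : X) - ((p (u n)).1 - (p (u n)).2)) := by
    intro n
    simp only [u, Function.iterate_succ_apply']
    rfl
  have hpart : ∀ n, ∑ i ∈ Finset.range n, (1 / 2 : ℝ) ^ (i + 1) • ((p (u i)).1 - (p (u i)).2)
      = y - (1 / 2 : ℝ) ^ (n + 1) • (u n : X) := by
    intro n
    induction n with
    | zero => simp [u]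
    | succ n ih =>
      rw [Finset.sum_range_succ, ih, hu, smul_smul, pow_succ _ (n + 1), mul_assoc]
      norm_num
      module
  obtain ⟨a, ha⟩ := summable_half_pow_smul (fun i => hAR _ (hpA (u i)))
  obtain ⟨b, hb⟩ := summable_half_pow_smul (fun i => hBR _ (hpB (u i)))
  have hab := (ha.sub hb).tendsto_sum_nat
  simp only [← smul_sub, hpart] at hab
  have hlim :
      Filter.Tendsto (fun n => (1 / 2 : ℝ) ^ (n + 1) • (u n : X)) Filter.atTop (nhds 0) := by
    refine squeeze_zero_norm (a := fun n : ℕ => (1 / 2 : ℝ) ^ (n + 1) * δ) (fun n => ?_) ?_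
    · rw [norm_smul, norm_pow, Real.norm_of_nonneg (by norm_num : (0 : ℝ) ≤ 1 / 2)]
      exact mul_le_mul_of_nonneg_left (u n).2.2.le (by positivity)
    · simpa using ((Filter.tendsto_add_atTop_iff_nat 1).2 (tendsto_pow_atTop_nhds_zero_of_lt_one
        (by norm_num : (0 : ℝ) ≤ 1 / 2) (by norm_num))).mul_const δ
  have hlim' := hlim.const_sub y
  rw [sub_zero] at hlim'
  rw [← tendsto_nhds_unique hab hlim']
  exact Set.sub_mem_sub (hA.hasSum_half_pow_mem hAc (fun i => hpA (u i)) ha)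
    (hB.hasSum_half_pow_mem hBc (fun i => hpB (u i)) hb)

/-- A convex subset of `X × ℝ` living over a closed subspace `S`, upward closed, lying above `0`
over the origin and containing a horizontal disc over `S` is supported at the origin by a
continuous linear functional. -/
theorem exists_clm_le_of_convex {K : Set (X × ℝ)} (hK : Convex ℝ K) (S : Submodule ℝ X)
    (hKS : ∀ p ∈ K, p.1 ∈ S) (hup : ∀ p ∈ K, ∀ t, p.2 ≤ t → (p.1, t) ∈ K)
    (h0 : ∀ t : ℝ, ((0 : X), t) ∈ K → 0 ≤ t) {δ M : ℝ} (hδ : 0 < δ)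
    (hM : ∀ y ∈ S, ‖y‖ < δ → (y, M) ∈ K) :
    ∃ a : X →L[ℝ] ℝ, ∀ p ∈ K, a p.1 ≤ p.2 := by
  let T : (S × ℝ) →L[ℝ] (X × ℝ) := S.subtypeL.prodMap (ContinuousLinearMap.id ℝ ℝ)
  set K' : Set (S × ℝ) := T ⁻¹' K with hK'
  have hmem : ∀ (y : S) (t : ℝ), (y, t) ∈ K' ↔ ((y : X), t) ∈ K := fun y t => Iff.rfl
  have hK'c : Convex ℝ K' := hK.linear_preimage (T : (S × ℝ) →ₗ[ℝ] (X × ℝ))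
  have hint : ((0 : S), M + 1) ∈ interior K' := by
    rw [mem_interior_iff_mem_nhds, nhds_prod_eq]
    refine Filter.mem_of_superset (Filter.prod_mem_prod (Metric.ball_mem_nhds (0 : S) hδ)
      (Ioi_mem_nhds (lt_add_one M))) ?_
    rintro ⟨y, t⟩ ⟨hy, ht⟩
    rw [hmem]
    refine hup _ (hM y y.2 ?_) t (le_of_lt ht)
    simpa using hy
  have h00 : ((0 : S), (0 : ℝ)) ∉ interior K' := by
    intro h
    have hc : Filter.Tendsto (fun t : ℝ => ((0 : S), t)) (nhds 0) (nhds ((0 : S), (0 : ℝ))) :=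
      (by fun_prop : Continuous fun t : ℝ => ((0 : S), t)).tendsto 0
    have := hc (mem_interior_iff_mem_nhds.1 h)
    obtain ⟨ε, hε, hb⟩ := Metric.mem_nhds_iff.1 this
    have hm : (-(ε / 2)) ∈ Metric.ball (0 : ℝ) ε := by
      rw [mem_ball_zero_iff, norm_neg, Real.norm_of_nonneg (by linarith)]
      linarith
    have := h0 _ ((hmem _ _).1 (hb hm))
    linarith
  obtain ⟨f, hf⟩ := geometric_hahn_banach_open_point hK'c.interior isOpen_interior h00
  have hf0 : f ((0 : S), (0 : ℝ)) = 0 := map_zero f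
  have hfK : ∀ p ∈ K', f p ≤ 0 := by
    intro p hp
    have hcl : p ∈ closure (interior K') := by
      rw [hK'c.closure_interior_eq_closure_of_nonempty_interior ⟨_, hint⟩]
      exact subset_closure hp
    exact closure_minimal (fun q hq => (hf q hq).le.trans_eq hf0)
      (isClosed_le f.continuous continuous_const) hcl
  have hsplit : ∀ (y : S) (t : ℝ), f (y, t) = f (y, 0) + t * f (0, 1) := by
    intro y t
    have : ((y, t) : S × ℝ) = (y, 0) + t • ((0 : S), (1 : ℝ)) := by simp
    rw [this, map_add, map_smul, smul_eq_mul]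
  set q := f ((0 : S), (1 : ℝ)) with hq
  have hq0 : q < 0 := by
    have h1 := hf _ hint
    have h2 : ((0 : S), M) ∈ K' := by
      rw [hmem]
      exact hM _ S.zero_mem (by simpa using hδ)
    have h3 := hfK _ (show ((0 : S), max M 0 + 1) ∈ K' from
      (hmem _ _).2 (hup _ ((hmem _ _).1 h2) _ (by simp only []; linarith [le_max_left M 0])))
    have h4 : (0 : ℝ) ≤ M := h0 M h2
    rw [hf0, hsplit, show f ((0 : S), (0 : ℝ)) = 0 from hf0] at h1
    nlinarith
  obtain ⟨a, ha, -⟩ := exists_extension_norm_eq S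
    ((-q⁻¹) • f.comp (ContinuousLinearMap.inl ℝ S ℝ))
  refine ⟨a, fun p hp => ?_⟩
  have h1 := hfK (⟨p.1, hKS p hp⟩, p.2) hp
  have h2 := ha ⟨p.1, hKS p hp⟩
  rw [hsplit] at h1
  simp only [smul_apply, ContinuousLinearMap.comp_apply,
    ContinuousLinearMap.inl_apply, smul_eq_mul] at h2
  rw [h2]
  set w := f (⟨p.1, hKS p hp⟩, (0 : ℝ))
  have h3 : w ≤ p.2 * (-q) := by linarith
  rw [← div_le_iff₀ (by linarith)] at h3
  rwa [neg_mul, ← div_eq_inv_mul, ← div_neg]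

/-- The conclusion of Fenchel duality for the pair of epigraphs `C₁`, `C₂`: every upper bound `r`
of the conjugate of the sum at `xs` is an upper bound of a splitting of `xs`. -/
def HasConjSplitting (C₁ C₂ : Set (X × ℝ)) : Prop :=
  ∀ (xs : X →L[ℝ] ℝ) (r : ℝ), (∀ x s t, (x, s) ∈ C₁ → (x, t) ∈ C₂ → xs x - (s + t) ≤ r) →
    ∃ a b : X →L[ℝ] ℝ, a + b = xs ∧
      ∀ p ∈ C₁, ∀ q ∈ C₂, (a p.1 - p.2) + (b q.1 - q.2) ≤ r

/-- Fenchel duality when the differences of the two convex sets cover a disc of a closed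
subspace with uniformly bounded heights. -/
theorem hasConjSplitting_of_bounded {C₁ C₂ : Set (X × ℝ)} (h₁ : Convex ℝ C₁) (h₂ : Convex ℝ C₂)
    (S : Submodule ℝ X) (hS : ∀ p ∈ C₁, ∀ q ∈ C₂, p.1 - q.1 ∈ S) {δ M R : ℝ} (hδ : 0 < δ)
    (hM : ∀ y ∈ S, ‖y‖ < δ → ∃ p ∈ C₁, ∃ q ∈ C₂, p.1 - q.1 = y ∧ p.2 + q.2 ≤ M ∧ ‖q.1‖ ≤ R) :
    HasConjSplitting C₁ C₂ := by
  intro xs r h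
  let K : Set (X × ℝ) := {y | ∃ p ∈ C₁, ∃ q ∈ C₂, p.1 - q.1 = y.1 ∧ p.2 + q.2 - xs q.1 + r ≤ y.2}
  have hK : Convex ℝ K := by
    rintro y ⟨p, hp, q, hq, hy, hyt⟩ y' ⟨p', hp', q', hq', hy', hyt'⟩ a b ha hb hab
    refine ⟨a • p + b • p', h₁ hp hp' ha hb hab, a • q + b • q', h₂ hq hq' ha hb hab, ?_, ?_⟩
    · simp only [Prod.fst_add, Prod.smul_fst, ← hy, ← hy']
      module
    · simp only [Prod.fst_add, Prod.smul_fst, Prod.snd_add, Prod.smul_snd, smul_eq_mul, map_add,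
        map_smul]
      have e1 := mul_le_mul_of_nonneg_left hyt ha
      have e2 := mul_le_mul_of_nonneg_left hyt' hb
      have e3 : r = a * r + b * r := by rw [← add_mul, hab, one_mul]
      linarith
  obtain ⟨a, ha⟩ := exists_clm_le_of_convex hK S
    (by
      rintro y ⟨p, hp, q, hq, hy, -⟩
      exact hy ▸ hS p hp q hq)
    (by
      rintro y ⟨p, hp, q, hq, hy, hyt⟩ t ht
      exact ⟨p, hp, q, hq, hy, hyt.trans ht⟩)
    (by
      rintro t ⟨p, hp, q, hq, hy, hyt⟩
      have hpq : p.1 = q.1 := sub_eq_zero.1 hy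
      have := h q.1 p.2 q.2 (hpq ▸ hp) hq
      simp only [] at hyt
      linarith)
    hδ (M := M + ‖xs‖ * R + r) (by
      intro y hy hyδ
      obtain ⟨p, hp, q, hq, hpq, hle, hR⟩ := hM y hy hyδ
      refine ⟨p, hp, q, hq, hpq, ?_⟩
      have e1 : |xs q.1| ≤ ‖xs‖ * R :=
        (xs.le_opNorm q.1).trans (mul_le_mul_of_nonneg_left hR (norm_nonneg _))
      have e2 := neg_abs_le (xs q.1)
      simp only []
      linarith)
  refine ⟨a, xs - a, by abel, fun p hp q hq => ?_⟩
  have := ha (p.1 - q.1, p.2 + q.2 - xs q.1 + r) ⟨p, hp, q, hq, rfl, le_rfl⟩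
  simp only [map_sub] at this
  rw [sub_apply]
  linarith

/-- `C` is cut out by finitely many affine inequalities from a convex set having `u ∈ C` as a
relative interior point. -/
def IsRegularAt {E : Type*} [AddCommGroup E] [Module ℝ E] (C : Set E) (u : E) : Prop :=
  u ∈ C ∧ ∃ (D : Set E) (n : ℕ) (l : Fin n → E →ᵃ[ℝ] ℝ), Convex ℝ D ∧ IsAlgRelInterior D u ∧
    ∀ z, z ∈ C ↔ z ∈ D ∧ ∀ k, l k z ≤ 0

/-- Fenchel duality in finite dimensions for two sets regular over a common point. -/
theorem hasConjSplitting_of_isRegularAt [FiniteDimensional ℝ X] {C₁ C₂ : Set (X × ℝ)} {u : X}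
    {s t : ℝ} (h₁ : IsRegularAt C₁ (u, s)) (h₂ : IsRegularAt C₂ (u, t)) :
    HasConjSplitting C₁ C₂ := by
  intro xs r h
  obtain ⟨hu₁, D₁, n₁, l₁, hD₁, hi₁, hC₁⟩ := h₁
  obtain ⟨hu₂, D₂, n₂, l₂, hD₂, hi₂, hC₂⟩ := h₂
  let B := Module.finBasis ℝ X
  let P := (X × ℝ) × (X × ℝ)
  let π₁ : P →ₗ[ℝ] X × ℝ := LinearMap.fst ℝ _ _
  let π₂ : P →ₗ[ℝ] X × ℝ := LinearMap.snd ℝ _ _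
  let d : P →ₗ[ℝ] X := LinearMap.fst ℝ X ℝ ∘ₗ π₁ - LinearMap.fst ℝ X ℝ ∘ₗ π₂
  let l : (Fin n₁ ⊕ Fin n₂) ⊕ (Fin (Module.finrank ℝ X) ⊕ Fin (Module.finrank ℝ X)) →
      P →ᵃ[ℝ] ℝ :=
    Sum.elim (Sum.elim (fun i => (l₁ i).comp π₁.toAffineMap) fun i => (l₂ i).comp π₂.toAffineMap)
      (Sum.elim (fun k => (B.coord k ∘ₗ d).toAffineMap) fun k => (-(B.coord k ∘ₗ d)).toAffineMap)
  let L : P →ᵃ[ℝ] ℝ := (LinearMap.snd ℝ X ℝ ∘ₗ π₁ + LinearMap.snd ℝ X ℝ ∘ₗ π₂ -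
    (xs : X →ₗ[ℝ] ℝ) ∘ₗ LinearMap.fst ℝ X ℝ ∘ₗ π₂).toAffineMap + AffineMap.const ℝ P r
  have hL : ∀ z : P, L z = z.1.2 + z.2.2 - xs z.2.1 + r := fun z => rfl
  obtain ⟨c, hc, hcz⟩ := exists_multipliers l Finset.univ (hD₁.prod hD₂)
    (IsAlgRelInterior.prod hD₁ hD₂ hi₁ hi₂) (L := L)
    (by
      rintro ((i | i) | (k | k)) -
      · exact ((hC₁ _).1 hu₁).2 i
      · exact ((hC₂ _).1 hu₂).2 i
      · simp [l, d, π₁, π₂]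
      · simp [l, d, π₁, π₂])
    (by
      rintro ⟨⟨x, σ⟩, ⟨y, τ⟩⟩ ⟨hz₁, hz₂⟩ hz
      have m₁ : (x, σ) ∈ C₁ := (hC₁ _).2 ⟨hz₁, fun i => hz (.inl (.inl i)) (Finset.mem_univ _)⟩
      have m₂ : (y, τ) ∈ C₂ := (hC₂ _).2 ⟨hz₂, fun i => hz (.inl (.inr i)) (Finset.mem_univ _)⟩
      have hxy : x = y := by
        rw [← sub_eq_zero]
        refine B.ext_elem fun k => ?_
        have e1 : B.repr (x - y) k ≤ 0 := hz (.inr (.inl k)) (Finset.mem_univ _)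
        have e2 : -(B.repr (x - y) k) ≤ 0 := hz (.inr (.inr k)) (Finset.mem_univ _)
        rw [map_zero, Finsupp.zero_apply]
        linarith
      subst hxy
      have := h x σ τ m₁ m₂
      rw [hL]
      simp only []
      linarith)
  let a : X →L[ℝ] ℝ := LinearMap.toContinuousLinearMap
    (-∑ k, (c (.inr (.inl k)) - c (.inr (.inr k))) • B.coord k)
  have ha : ∀ x, a x = -∑ k, (c (.inr (.inl k)) - c (.inr (.inr k))) * B.repr x k := by
    intro x
    simp [a]
  refine ⟨a, xs - a, by abel, fun p hp q hq => ?_⟩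
  have hp' := (hC₁ p).1 hp
  have hq' := (hC₂ q).1 hq
  have h1 := hcz (p, q) ⟨hp'.1, hq'.1⟩
  rw [Fintype.sum_sum_type, Fintype.sum_sum_type, Fintype.sum_sum_type, hL] at h1
  have h2 : ∑ i, c (.inl (.inl i)) * l (.inl (.inl i)) (p, q) ≤ 0 :=
    Finset.sum_nonpos fun i _ => mul_nonpos_of_nonneg_of_nonpos (hc _) (hp'.2 i)
  have h3 : ∑ i, c (.inl (.inr i)) * l (.inl (.inr i)) (p, q) ≤ 0 :=
    Finset.sum_nonpos fun i _ => mul_nonpos_of_nonneg_of_nonpos (hc _) (hq'.2 i)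
  have h4 : ∑ k, c (.inr (.inl k)) * l (.inr (.inl k)) (p, q) +
      ∑ k, c (.inr (.inr k)) * l (.inr (.inr k)) (p, q) = -(a p.1 - a q.1) := by
    rw [← map_sub, ha, neg_neg, ← Finset.sum_add_distrib]
    refine Finset.sum_congr rfl fun k _ => ?_
    have e1 : l (.inr (.inl k)) (p, q) = B.repr (p.1 - q.1) k := rfl
    have e2 : l (.inr (.inr k)) (p, q) = -B.repr (p.1 - q.1) k := rfl
    rw [e1, e2]
    ring
  rw [sub_apply]
  simp only [] at h1
  linarith

theorem exists_add_smul_sub_mem_of_mem_intrinsicInterior {D : Set X} {u z : X}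
    (hu : u ∈ intrinsicInterior ℝ D) (hz : z ∈ D) : ∃ ε : ℝ, 0 < ε ∧ u + ε • (u - z) ∈ D := by
  obtain ⟨y, hy, rfl⟩ := mem_intrinsicInterior.1 hu
  let z' : affineSpan ℝ D := ⟨z, subset_affineSpan ℝ D hz⟩
  have hmem : ∀ t : ℝ, (y : X) + t • ((y : X) - z) ∈ affineSpan ℝ D := by
    intro t
    have h := AffineMap.lineMap_mem (-t) y.2 z'.2
    rw [AffineMap.lineMap_apply_module'] at h
    convert h using 1
    module
  have hc : Continuous fun t : ℝ => (⟨(y : X) + t • ((y : X) - z), hmem t⟩ : affineSpan ℝ D) :=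
    Continuous.subtype_mk (by fun_prop) _
  have h0 := (hc.tendsto 0)
  have hy0 : (⟨(y : X) + (0 : ℝ) • ((y : X) - z), hmem 0⟩ : affineSpan ℝ D) = y :=
    Subtype.ext (by simp)
  rw [hy0] at h0
  obtain ⟨ε, hε, hb⟩ := Metric.mem_nhds_iff.1 (h0 (mem_interior_iff_mem_nhds.1 hy))
  have hm : ε / 2 ∈ Metric.ball (0 : ℝ) ε := by
    rw [mem_ball_zero_iff, Real.norm_of_nonneg (by linarith)]
    linarith
  exact ⟨ε / 2, by linarith, hb hm⟩

theorem mem_epi_toReal {Y : Type*} {f : Y → EReal} {x : Y} (hb : f x ≠ ⊥) (ht : f x ≠ ⊤) :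
    (x, (f x).toReal) ∈ epi f :=
  (EReal.coe_toReal ht hb).ge

theorem ne_top_of_mem_epi {Y : Type*} {f : Y → EReal} {p : Y × ℝ} (hp : p ∈ epi f) : f p.1 ≠ ⊤ :=
  ne_top_of_le_ne_top (EReal.coe_ne_top _) hp

theorem toReal_le_of_mem_epi {Y : Type*} {f : Y → EReal} {p : Y × ℝ} (hb : f p.1 ≠ ⊥)
    (hp : p ∈ epi f) : (f p.1).toReal ≤ p.2 := by
  rw [← EReal.coe_le_coe_iff, EReal.coe_toReal (ne_top_of_mem_epi hp) hb]
  exact hp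

theorem mem_epi_add {Y : Type*} {f g : Y → EReal} {x : Y} {s t : ℝ} (hs : (x, s) ∈ epi f)
    (ht : (x, t) ∈ epi g) : (x, s + t) ∈ epi fun x => f x + g x := by
  have h : f x + g x ≤ (s : EReal) + t := add_le_add hs ht
  rwa [← EReal.coe_add] at h

theorem exists_of_mem_epi_add {Y : Type*} {f g : Y → EReal} (hf : ∀ x, f x ≠ ⊥)
    (hg : ∀ x, g x ≠ ⊥) {p : Y × ℝ} (hp : p ∈ epi fun x => f x + g x) :
    ∃ s t : ℝ, (p.1, s) ∈ epi f ∧ (p.1, t) ∈ epi g ∧ s + t ≤ p.2 := by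
  have h := ne_top_of_mem_epi hp
  have h1 : f p.1 ≠ ⊤ := fun e => h (by simp only [e, EReal.top_add_of_ne_bot (hg p.1)])
  have h2 : g p.1 ≠ ⊤ := fun e => h (by simp only [e, EReal.add_top_of_ne_bot (hf p.1)])
  refine ⟨_, _, mem_epi_toReal (hf _) h1, mem_epi_toReal (hg _) h2, ?_⟩
  rw [← EReal.toReal_add h1 (hf _) h2 (hg _)]
  exact toReal_le_of_mem_epi (f := fun x => f x + g x) (EReal.add_ne_bot_iff.2 ⟨hf _, hg _⟩) hp

theorem coe_sub_le_fConj {f : X → EReal} (a : X →L[ℝ] ℝ) {p : X × ℝ} (hp : p ∈ epi f) :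
    ((a p.1 - p.2 : ℝ) : EReal) ≤ fConj f a := by
  rw [EReal.coe_sub]
  exact (EReal.sub_le_sub le_rfl hp).trans (le_iSup (fun x => ((a x : ℝ) : EReal) - f x) p.1)

theorem fConj_le_coe {f : X → EReal} (hf : ∀ x, f x ≠ ⊥) {a : X →L[ℝ] ℝ} {r : ℝ}
    (h : ∀ p ∈ epi f, a p.1 - p.2 ≤ r) : fConj f a ≤ r := by
  refine iSup_le fun x => ?_
  by_cases ht : f x = ⊤
  · simp [ht]
  · rw [← EReal.coe_toReal ht (hf x), ← EReal.coe_sub, EReal.coe_le_coe_iff]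
    exact h _ (mem_epi_toReal (hf x) ht)

theorem fConj_add_fConj_le {f g : X → EReal} (hf : ∀ x, f x ≠ ⊥) (hg : ∀ x, g x ≠ ⊥)
    (hfd : ∃ x, f x ≠ ⊤) (hgd : ∃ x, g x ≠ ⊤) {a b : X →L[ℝ] ℝ} {r : ℝ}
    (h : ∀ p ∈ epi f, ∀ q ∈ epi g, (a p.1 - p.2) + (b q.1 - q.2) ≤ r) :
    fConj f a + fConj g b ≤ r := by
  obtain ⟨x, hx⟩ := hfd
  obtain ⟨y, hy⟩ := hgd
  have hp := mem_epi_toReal (hf x) hx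
  have hq := mem_epi_toReal (hg y) hy
  have hle : ∀ q ∈ epi g, fConj f a ≤ ((r - (b q.1 - q.2) : ℝ) : EReal) := fun q hq =>
    fConj_le_coe hf fun p hp => by linarith [h p hp q hq]
  have htop : fConj f a ≠ ⊤ := ne_top_of_le_ne_top (EReal.coe_ne_top _) (hle _ hq)
  have hbot : fConj f a ≠ ⊥ := ne_bot_of_le_ne_bot (EReal.coe_ne_bot _) (coe_sub_le_fConj a hp)
  lift fConj f a to ℝ using ⟨htop, hbot⟩ with α
  have hg' : fConj g b ≤ ((r - α : ℝ) : EReal) := fConj_le_coe hg fun q hq => by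
    linarith [EReal.coe_le_coe_iff.1 (hle q hq)]
  calc (α : EReal) + fConj g b ≤ α + ((r - α : ℝ) : EReal) := add_le_add le_rfl hg'
    _ = r := by
      rw [← EReal.coe_add]
      congr 1
      ring

theorem fConj_add_le {f g : X → EReal} (hf : ∀ x, f x ≠ ⊥) (hg : ∀ x, g x ≠ ⊥)
    (a b : X →L[ℝ] ℝ) : fConj (fun x => f x + g x) (a + b) ≤ fConj f a + fConj g b := by
  refine iSup_le fun x => ?_
  by_cases hft : f x = ⊤
  · simp [hft, EReal.top_add_of_ne_bot (hg x)]
  by_cases hgt : g x = ⊤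
  · simp [hgt, EReal.add_top_of_ne_bot (hf x)]
  have e1 := coe_sub_le_fConj a (mem_epi_toReal (hf x) hft)
  have e2 := coe_sub_le_fConj b (mem_epi_toReal (hg x) hgt)
  refine le_trans (le_of_eq ?_) (add_le_add e1 e2)
  dsimp only
  conv_lhs => rw [← EReal.coe_toReal hft (hf x), ← EReal.coe_toReal hgt (hg x)]
  rw [← EReal.coe_add, ← EReal.coe_sub, ← EReal.coe_add, add_apply]
  congr 1
  ring

theorem mem_subdiff_iff {f : X → EReal} (hf : ∀ x, f x ≠ ⊥) {x : X} (hx : f x ≠ ⊤)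
    {a : X →L[ℝ] ℝ} :
    a ∈ subdiff f x ↔ ∀ p ∈ epi f, a p.1 - p.2 ≤ a x - (f x).toReal := by
  have hcoe := EReal.coe_toReal hx (hf x)
  constructor
  · intro h p hp
    have hpt := ne_top_of_mem_epi hp
    have h1 := h p.1
    rw [← hcoe, ← EReal.coe_toReal hpt (hf _), ← EReal.coe_sub, EReal.coe_le_coe_iff] at h1
    linarith [toReal_le_of_mem_epi (hf _) hp]
  · intro h y
    by_cases hy : f y = ⊤
    · rw [hy, ← hcoe, EReal.top_sub_coe]
      exact le_top
    · have h1 := h _ (mem_epi_toReal (hf y) hy)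
      rw [← hcoe, ← EReal.coe_toReal hy (hf _), ← EReal.coe_sub, EReal.coe_le_coe_iff]
      simp only [] at h1
      linarith

theorem subdiff_add {f g : X → EReal} (hf : ∀ x, f x ≠ ⊥) (hg : ∀ x, g x ≠ ⊥)
    (h : HasConjSplitting (epi f) (epi g)) {x : X} (hfx : f x ≠ ⊤) (hgx : g x ≠ ⊤) :
    subdiff (fun x => f x + g x) x = subdiff f x + subdiff g x := by
  have hfg : ∀ x, f x + g x ≠ ⊥ := fun x => EReal.add_ne_bot_iff.2 ⟨hf x, hg x⟩
  have hfgx : f x + g x ≠ ⊤ := EReal.add_ne_top hfx hgx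
  have hreal : (f x + g x).toReal = (f x).toReal + (g x).toReal :=
    EReal.toReal_add hfx (hf x) hgx (hg x)
  have hp := mem_epi_toReal (hf x) hfx
  have hq := mem_epi_toReal (hg x) hgx
  ext xs
  rw [mem_subdiff_iff (f := fun x => f x + g x) hfg hfgx, Set.mem_add, hreal]
  constructor
  · intro hxs
    obtain ⟨a, b, rfl, hab⟩ := h xs _ fun y s t hs ht => hxs (y, s + t) (mem_epi_add hs ht)
    simp only [add_apply] at hab
    refine ⟨a, (mem_subdiff_iff hf hfx).2 fun p hp => ?_, b,
      (mem_subdiff_iff hg hgx).2 fun q hq => ?_, rfl⟩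
    · have := hab p hp _ hq
      simp only [] at this
      linarith
    · have := hab _ hp q hq
      simp only [] at this
      linarith
  · rintro ⟨a, ha, b, hb, rfl⟩ p hp
    obtain ⟨s, t, hs, ht, hst⟩ := exists_of_mem_epi_add hf hg hp
    have e1 := (mem_subdiff_iff hf hfx).1 ha _ hs
    have e2 := (mem_subdiff_iff hg hgx).1 hb _ ht
    simp only [add_apply] at e1 e2 ⊢
    linarith

/-- The dual value is attained as soon as the conjugate of the sum is finite. -/
theorem exists_fConj_add_eq {f g : X → EReal} (hf : ∀ x, f x ≠ ⊥) (hg : ∀ x, g x ≠ ⊥)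
    (hfd : ∃ x, f x ≠ ⊤) (hgd : ∃ x, g x ≠ ⊤) (h : HasConjSplitting (epi f) (epi g))
    {xs : X →L[ℝ] ℝ} {r : ℝ} (hr : fConj (fun x => f x + g x) xs = r) :
    ∃ a b : X →L[ℝ] ℝ, a + b = xs ∧
      fConj (fun x => f x + g x) xs = fConj f a + fConj g b := by
  obtain ⟨a, b, rfl, hab⟩ := h xs r fun x s t hs ht => by
    rw [← EReal.coe_le_coe_iff, ← hr]
    exact coe_sub_le_fConj xs (mem_epi_add hs ht)
  exact ⟨a, b, rfl, le_antisymm (fConj_add_le hf hg a b)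
    (hr ▸ fConj_add_fConj_le hf hg hfd hgd hab)⟩

theorem isRegularAt_epi_of_isPolyFun {f : X → EReal} (h : IsPolyFun f) {p : X × ℝ}
    (hp : p ∈ epi f) : IsRegularAt (epi f) p := by
  obtain ⟨m, a, c, b, he⟩ := h
  refine ⟨hp, Set.univ, m, fun i => ((a i : X →ₗ[ℝ] ℝ).coprod (c i • LinearMap.id)).toAffineMap -
    AffineMap.const ℝ (X × ℝ) (b i), convex_univ, isAlgRelInterior_univ p, fun z => ?_⟩
  rw [he]
  simp

theorem isRegularAt_epi_of_mem_intrinsicInterior {f : X → EReal} (hf : ∀ x, f x ≠ ⊥)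
    (hc : Convex ℝ (epi f)) {u : X} (hu : u ∈ intrinsicInterior ℝ {x | f x ≠ ⊤}) :
    IsRegularAt (epi f) (u, (f u).toReal + 1) := by
  have hut : f u ≠ ⊤ := intrinsicInterior_subset hu
  have hu0 := mem_epi_toReal (hf u) hut
  have hup : ∀ {x : X} {s t : ℝ}, (x, s) ∈ epi f → s ≤ t → (x, t) ∈ epi f := fun hs hst =>
    le_trans (show f _ ≤ _ from hs) (EReal.coe_le_coe_iff.2 hst)
  have hu1 : (u, (f u).toReal + 1) ∈ epi f := hup hu0 (by linarith)
  refine ⟨hu1, epi f, 0, Fin.elim0, hc, ⟨hu1, ?_⟩, fun z => by simp⟩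
  rintro ⟨z, ν⟩ hz
  obtain ⟨ε, hε, hw⟩ := exists_add_smul_sub_mem_of_mem_intrinsicInterior hu (ne_top_of_mem_epi hz)
  have hw0 := mem_epi_toReal (hf _) hw
  set w := u + ε • (u - z) with hwdef
  set μ := (f u).toReal
  set ω := (f w).toReal
  set D := |ω - μ| + ε * |μ + 1 - ν| + 1 with hD
  have hDpos : 1 ≤ D := by
    have := abs_nonneg (ω - μ)
    have := mul_nonneg hε.le (abs_nonneg (μ + 1 - ν))
    linarith
  have hs0 : 0 < 1 / D := by positivity
  have hs1 : 1 / D ≤ 1 := (div_le_one (by linarith)).2 hDpos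
  have hsD : 1 / D * D = 1 := div_mul_cancel₀ _ (by linarith)
  set s := 1 / D
  refine ⟨s * ε, by positivity, ?_⟩
  have hm := hc hu0 hw0 (a := 1 - s) (b := s) (by linarith) hs0.le (by ring)
  have hx : ((u, μ + 1) : X × ℝ) + (s * ε) • (((u, μ + 1) : X × ℝ) - (z, ν)) =
      ((1 - s) • u + s • w, μ + 1 + s * ε * (μ + 1 - ν)) := by
    rw [hwdef]
    ext
    · simp only [Prod.fst_add, Prod.smul_fst, Prod.fst_sub]
      module
    · simp
  rw [hx]
  refine hup hm ?_
  simp only [Prod.smul_snd, smul_eq_mul]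
  have e1 := mul_le_mul_of_nonneg_left (le_abs_self (ω - μ)) hs0.le
  have e2 := mul_le_mul_of_nonneg_left (neg_abs_le (μ + 1 - ν)) (mul_nonneg hs0.le hε.le)
  have e3 : s * |ω - μ| + s * ε * |μ + 1 - ν| + s = 1 := by
    linear_combination hsD - s * hD
  linarith

theorem hasConjSplitting_of_continuousAt {f g : X → EReal} (hf : ∀ x, f x ≠ ⊥)
    (hg : ∀ x, g x ≠ ⊥) (hfc : Convex ℝ (epi f)) (hgc : Convex ℝ (epi g)) {u : X}
    (hfu : f u ≠ ⊤) (hgu : g u ≠ ⊤) (hcont : ContinuousAt f u) :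
    HasConjSplitting (epi f) (epi g) := by
  have hlt : f u < (((f u).toReal + 1 : ℝ) : EReal) := by
    conv_lhs => rw [← EReal.coe_toReal hfu (hf u)]
    exact EReal.coe_lt_coe_iff.2 (by linarith)
  obtain ⟨δ, hδ, hb⟩ := Metric.mem_nhds_iff.1 (hcont.eventually (gt_mem_nhds hlt))
  refine hasConjSplitting_of_bounded hfc hgc ⊤ (fun _ _ _ _ => trivial) hδ
    (M := (f u).toReal + 1 + (g u).toReal) (R := ‖u‖) fun y _ hy => ?_
  have hm : u + y ∈ Metric.ball u δ := by simpa using hy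
  exact ⟨(u + y, (f u).toReal + 1), show f (u + y) ≤ _ from (hb hm).le, _,
    mem_epi_toReal (hg u) hgu, add_sub_cancel_left u y, le_rfl, le_rfl⟩

/-- The points of norm at most `n` at which `f` is at most `n`. -/
def boundedSublevel (f : X → EReal) (n : ℕ) : Set X := {x | (x, (n : ℝ)) ∈ epi f ∧ ‖x‖ ≤ n}

theorem convex_boundedSublevel {f : X → EReal} (hf : Convex ℝ (epi f)) (n : ℕ) :
    Convex ℝ (boundedSublevel f n) := by
  intro x hx y hy a b ha hb hab
  constructor
  · have h := hf hx.1 hy.1 ha hb hab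
    rwa [Prod.smul_mk, Prod.smul_mk, Prod.mk_add_mk, ← add_smul, hab, one_smul] at h
  · have hx' := mem_closedBall_zero_iff.2 hx.2
    have hy' := mem_closedBall_zero_iff.2 hy.2
    exact mem_closedBall_zero_iff.1 (convex_closedBall (0 : X) n hx' hy' ha hb hab)

theorem isClosed_boundedSublevel {Y : Type*} [NormedAddCommGroup Y] {f : Y → EReal}
    (hf : IsClosed (epi f)) (n : ℕ) :
    IsClosed (boundedSublevel f n) :=
  (hf.preimage (by fun_prop : Continuous fun x : Y => (x, (n : ℝ)))).inter
    (isClosed_le continuous_norm continuous_const)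

theorem exists_forall_mem_boundedSublevel {Y : Type*} [NormedAddCommGroup Y] {f : Y → EReal}
    (hf : ∀ x, f x ≠ ⊥) {x : Y} (hx : f x ≠ ⊤) : ∃ N : ℕ, ∀ n ≥ N, x ∈ boundedSublevel f n := by
  obtain ⟨N, hN⟩ := exists_nat_ge (max (f x).toReal ‖x‖)
  refine ⟨N, fun n hn => ?_⟩
  have hn' : (N : ℝ) ≤ n := Nat.cast_le.2 hn
  refine ⟨?_, ((le_max_right _ _).trans hN).trans hn'⟩
  exact le_trans (show f x ≤ _ from mem_epi_toReal (hf x) hx)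
    (EReal.coe_le_coe_iff.2 (((le_max_left _ _).trans hN).trans hn'))

/-- Fenchel duality in Banach spaces under the Attouch–Brezis condition. -/
theorem hasConjSplitting_of_zeroSqri [CompleteSpace X] {f g : X → EReal} (hf : ∀ x, f x ≠ ⊥)
    (hg : ∀ x, g x ≠ ⊥) (hfc : Convex ℝ (epi f)) (hgc : Convex ℝ (epi g))
    (hfcl : IsClosed (epi f)) (hgcl : IsClosed (epi g))
    (h : ZeroSqri ({x | f x ≠ ⊤} - {x | g x ≠ ⊤})) : HasConjSplitting (epi f) (epi g) := by
  obtain ⟨⟨u, hfu, u', hgu, huu⟩, S, hS, hScl⟩ := h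
  obtain rfl : u = u' := sub_eq_zero.1 huu
  have hSmem : ∀ {x y : X}, f x ≠ ⊤ → g y ≠ ⊤ → x - y ∈ S := by
    intro x y hx hy
    have : x - y ∈ coneGen ({x | f x ≠ ⊤} - {x | g x ≠ ⊤}) :=
      ⟨1, zero_le_one, x - y, ⟨x, hx, y, hy, rfl⟩, (one_smul _ _).symm⟩
    rwa [← hS] at this
  let A := boundedSublevel f
  let B := boundedSublevel g
  have hAB : ∀ n, Convex ℝ (A n - B n) := fun n =>
    (convex_boundedSublevel hfc n).sub (convex_boundedSublevel hgc n)
  have hABS : ∀ n, A n - B n ⊆ S := by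
    rintro n _ ⟨x, hx, y, hy, rfl⟩
    exact hSmem (ne_top_of_mem_epi hx.1) (ne_top_of_mem_epi hy.1)
  have habs : ∀ y ∈ S, ∃ N : ℕ, ∀ n ≥ N, 0 < n ∧ (1 / (n : ℝ)) • y ∈ A n - B n := by
    intro y hy
    have hy' : y ∈ coneGen ({x | f x ≠ ⊤} - {x | g x ≠ ⊤}) := hS ▸ hy
    obtain ⟨t, ht, _, ⟨x₁, hx₁, x₂, hx₂, rfl⟩, rfl⟩ := hy'
    obtain ⟨N₁, h₁⟩ := exists_forall_mem_boundedSublevel hf hfu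
    obtain ⟨N₂, h₂⟩ := exists_forall_mem_boundedSublevel hg hgu
    obtain ⟨N₃, h₃⟩ := exists_forall_mem_boundedSublevel hf hx₁
    obtain ⟨N₄, h₄⟩ := exists_forall_mem_boundedSublevel hg hx₂
    obtain ⟨N₅, h₅⟩ := exists_nat_ge t
    refine ⟨max (max N₁ N₂) (max N₃ N₄) + N₅ + 1, fun n hn => ⟨by omega, ?_⟩⟩
    have hn0 : (0 : ℝ) < n := Nat.cast_pos.2 (by omega)
    have htn : t ≤ n := h₅.trans (Nat.cast_le.2 (by omega))
    have hz : (0 : X) ∈ A n - B n :=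
      ⟨u, h₁ n (by omega), u, h₂ n (by omega), sub_self u⟩
    have hd : x₁ - x₂ ∈ A n - B n := Set.sub_mem_sub (h₃ n (by omega)) (h₄ n (by omega))
    have := (hAB n).smul_mem_of_zero_mem hz hd (t := 1 / (n : ℝ) * t)
      ⟨by positivity, by rwa [one_div, ← div_eq_inv_mul, div_le_one hn0]⟩
    rwa [smul_smul]
  let Z : ℕ → Set S := fun n =>
    {y | 0 < n ∧ (1 / (n : ℝ)) • (y : X) ∈ closure (A n - B n) ∧
      (1 / (n : ℝ)) • (-(y : X)) ∈ closure (A n - B n)}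
  have hZcl : ∀ n, IsClosed (Z n) := fun n =>
    isClosed_const.inter ((isClosed_closure.preimage (by fun_prop)).inter
      (isClosed_closure.preimage (by fun_prop)))
  have hZun : ⋃ n, Z n = Set.univ := by
    refine Set.eq_univ_of_forall fun y => Set.mem_iUnion.2 ?_
    obtain ⟨N₁, h₁⟩ := habs y y.2
    obtain ⟨N₂, h₂⟩ := habs (-y) (S.neg_mem y.2)
    have e₁ := h₁ (max N₁ N₂) (le_max_left _ _)
    have e₂ := h₂ (max N₁ N₂) (le_max_right _ _)
    exact ⟨max N₁ N₂, e₁.1, subset_closure e₁.2, subset_closure e₂.2⟩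
  have : CompleteSpace S := hScl.completeSpace_coe
  obtain ⟨n, y₀, hy₀⟩ := nonempty_interior_of_iUnion_of_closed hZcl hZun
  obtain ⟨δ, hδ, hball⟩ := Metric.mem_nhds_iff.1 (mem_interior_iff_mem_nhds.1 hy₀)
  have hn : 0 < n := (hball (Metric.mem_ball_self hδ)).1
  have hn0 : (0 : ℝ) < n := Nat.cast_pos.2 hn
  have hclos : ∀ y ∈ S, ‖y‖ < δ / (2 * n) → y ∈ closure (A n - B n) := by
    intro y hy hyδ
    have hm : y₀ + (2 * n : ℝ) • (⟨y, hy⟩ : S) ∈ Metric.ball y₀ δ := by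
      rw [mem_ball_iff_norm, add_sub_cancel_left, norm_smul,
        Real.norm_of_nonneg (by positivity), mul_comm]
      exact (lt_div_iff₀ (by positivity)).1 hyδ
    have e₁ := (hball hm).2.1
    have e₂ := (hball (Metric.mem_ball_self hδ)).2.2
    have e₃ := (hAB n).closure e₁ e₂ (a := 1 / 2) (b := 1 / 2) (by norm_num) (by norm_num)
      (by norm_num)
    convert e₃ using 1
    simp only [Submodule.coe_add, Submodule.coe_smul]
    rw [← sub_eq_zero]
    match_scalars <;> field_simp <;> norm_num
  refine hasConjSplitting_of_bounded hfc hgc S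
    (fun p hp q hq => hSmem (ne_top_of_mem_epi hp) (ne_top_of_mem_epi hq))
    (δ := δ / (2 * n) / 2) (by positivity) (M := n + n) (R := n) fun y hy hyδ => ?_
  obtain ⟨x₁, h₁, x₂, h₂, rfl⟩ := mem_sub_of_ball_subset_closure
    (convex_boundedSublevel hfc n) (convex_boundedSublevel hgc n) (isClosed_boundedSublevel hfcl n)
    (isClosed_boundedSublevel hgcl n) (fun x hx => hx.2) (fun x hx => hx.2) (hABS n)
    (by positivity) hclos hy hyδ
  exact ⟨(x₁, n), h₁.1, (x₂, n), h₂.1, rfl, le_rfl, h₂.2⟩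

/-- Fenchel conjugate and subdifferential sum rules for proper convex functions. -/
theorem fenchel_and_subdiff_sum_rule (f1 f2 : X → EReal)
    (hb1 : ∀ x, f1 x ≠ ⊥) (hb2 : ∀ x, f2 x ≠ ⊥)
    (hd1 : ∃ x, f1 x ≠ ⊤) (hd2 : ∃ x, f2 x ≠ ⊤)
    (hc1 : Convex ℝ (epi f1)) (hc2 : Convex ℝ (epi f2))
    (hqc :
      (FiniteDimensional ℝ X ∧
        (intrinsicInterior ℝ {x | f1 x ≠ ⊤} ∩ intrinsicInterior ℝ {x | f2 x ≠ ⊤}).Nonempty) ∨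
      (FiniteDimensional ℝ X ∧ IsPolyFun f2 ∧
        (intrinsicInterior ℝ {x | f1 x ≠ ⊤} ∩ {x | f2 x ≠ ⊤}).Nonempty) ∨
      (∃ ub, ub ∈ ({x | f1 x ≠ ⊤} ∩ {x | f2 x ≠ ⊤}) ∧ ContinuousAt f1 ub) ∨
      (FiniteDimensional ℝ X ∧ IsPolyFun f1 ∧ IsPolyFun f2 ∧
        ({x | f1 x ≠ ⊤} ∩ {x | f2 x ≠ ⊤}).Nonempty) ∨
      (CompleteSpace X ∧ IsClosed (epi f1) ∧ IsClosed (epi f2) ∧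
        ZeroSqri ({x | f1 x ≠ ⊤} - {x | f2 x ≠ ⊤}))) :
    (∀ xs : X →L[ℝ] ℝ,
      fConj (fun x => f1 x + f2 x) xs =
        sInf {z : EReal | ∃ a b : X →L[ℝ] ℝ, a + b = xs ∧ z = fConj f1 a + fConj f2 b}) ∧
    (∀ (xs : X →L[ℝ] ℝ) (r : ℝ), fConj (fun x => f1 x + f2 x) xs = (r : EReal) →
      ∃ a b : X →L[ℝ] ℝ, a + b = xs ∧
        fConj (fun x => f1 x + f2 x) xs = fConj f1 a + fConj f2 b) ∧
    (∀ xb : X, f1 xb ≠ ⊤ → f2 xb ≠ ⊤ →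
      subdiff (fun x => f1 x + f2 x) xb = subdiff f1 xb + subdiff f2 xb) := by
  have hsplit : HasConjSplitting (epi f1) (epi f2) := by
    rcases hqc with ⟨_, u, h₁, h₂⟩ | ⟨_, hp, u, h₁, h₂⟩ | ⟨u, ⟨h₁, h₂⟩, hu⟩ |
      ⟨_, hp₁, hp₂, u, h₁, h₂⟩ | ⟨_, hcl₁, hcl₂, h⟩
    · exact hasConjSplitting_of_isRegularAt (isRegularAt_epi_of_mem_intrinsicInterior hb1 hc1 h₁)
        (isRegularAt_epi_of_mem_intrinsicInterior hb2 hc2 h₂)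
    · exact hasConjSplitting_of_isRegularAt (isRegularAt_epi_of_mem_intrinsicInterior hb1 hc1 h₁)
        (isRegularAt_epi_of_isPolyFun hp (mem_epi_toReal (hb2 u) h₂))
    · exact hasConjSplitting_of_continuousAt hb1 hb2 hc1 hc2 h₁ h₂ hu
    · exact hasConjSplitting_of_isRegularAt
        (isRegularAt_epi_of_isPolyFun hp₁ (mem_epi_toReal (hb1 u) h₁))
        (isRegularAt_epi_of_isPolyFun hp₂ (mem_epi_toReal (hb2 u) h₂))
    · exact hasConjSplitting_of_zeroSqri hb1 hb2 hc1 hc2 hcl₁ hcl₂ h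
  have hdom : ∃ u, f1 u ≠ ⊤ ∧ f2 u ≠ ⊤ := by
    rcases hqc with ⟨_, u, h₁, h₂⟩ | ⟨_, hp, u, h₁, h₂⟩ | ⟨u, h, _⟩ | ⟨_, _, _, u, h⟩ |
      ⟨_, _, _, ⟨u, h₁, v, h₂, huv⟩, _⟩
    · exact ⟨u, intrinsicInterior_subset h₁, intrinsicInterior_subset h₂⟩
    · exact ⟨u, intrinsicInterior_subset h₁, h₂⟩
    · exact ⟨u, h⟩
    · exact ⟨u, h⟩
    · exact ⟨u, h₁, by rwa [sub_eq_zero.1 huv]⟩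
  have hattain := fun (xs : X →L[ℝ] ℝ) (r : ℝ)
    (hr : fConj (fun x => f1 x + f2 x) xs = (r : EReal)) =>
      exists_fConj_add_eq hb1 hb2 hd1 hd2 hsplit hr
  refine ⟨fun xs => le_antisymm (le_sInf ?_) ?_, hattain,
    fun xb h₁ h₂ => subdiff_add hb1 hb2 hsplit h₁ h₂⟩
  · rintro _ ⟨a, b, rfl, rfl⟩
    exact fConj_add_le hb1 hb2 a b
  · obtain ⟨u, h₁, h₂⟩ := hdom
    have hbot : fConj (fun x => f1 x + f2 x) xs ≠ ⊥ :=
      ne_bot_of_le_ne_bot (EReal.coe_ne_bot _) (coe_sub_le_fConj xs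
        (mem_epi_add (mem_epi_toReal (hb1 u) h₁) (mem_epi_toReal (hb2 u) h₂)))
    by_cases htop : fConj (fun x => f1 x + f2 x) xs = ⊤
    · exact htop ▸ le_top
    · obtain ⟨a, b, hab, h⟩ := hattain xs _ (EReal.coe_toReal htop hbot).symm
      exact sInf_le ⟨a, b, hab, h⟩

end
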